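/- arXiv:1902.01499 — 4 statements merged into one kernel-verified Lean document; each statement's English description precedes it below -/
import Mathlib

section
/- Advanced composition (non-adaptive form): Let M_1, ..., M_k be mechanisms, each mapping datasets D ∈ 𝓓^n to probability measures on output spaces R_i, and suppose each M_i is (ε', 0)-differentially private. Then for any δ ∈ (0, 1), the combined mechanism mapping D to the product measure M_1(D) ⊗ ... ⊗ M_k(D) is (ε, δ)-differentially private with ε = √(2k · ln(1/δ)) · ε' + k · ε' · (e^{ε'} − 1). -/
open MeasureTheory

/-- Two datasets (tuples of `n` rows from `𝓓`) are neighboring if they differ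
in at most one coordinate. -/
def Neighboring {𝓓 : Type*} {n : ℕ} (D D' : Fin n → 𝓓) : Prop :=
  ∃ i : Fin n, ∀ j : Fin n, j ≠ i → D j = D' j

/-- A mechanism `M` from datasets to probability measures on `R` is
`(ε, δ)`-differentially private. -/
def DiffPrivate {𝓓 : Type*} {n : ℕ} {R : Type*} [MeasurableSpace R]
    (M : (Fin n → 𝓓) → Measure R) (ε δ : ℝ) : Prop :=
  ∀ D D' : Fin n → 𝓓, Neighboring D D' → ∀ S : Set R, MeasurableSet S →
    M D S ≤ ENNReal.ofReal (Real.exp ε) * M D' S + ENNReal.ofReal δ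

open ProbabilityTheory Set

/-- Two finite measures that dominate each other up to a factor `exp ε` have a log-likelihood ratio
with values in `[-ε, ε]`. -/
theorem exists_logLikelihoodRatio_mem_Icc {α : Type*} [MeasurableSpace α] {μ ν : Measure α}
    [IsFiniteMeasure μ] [IsFiniteMeasure ν] {ε : ℝ} (hε : 0 ≤ ε)
    (hμν : ∀ s, MeasurableSet s → μ s ≤ ENNReal.ofReal (Real.exp ε) * ν s)
    (hνμ : ∀ s, MeasurableSet s → ν s ≤ ENNReal.ofReal (Real.exp ε) * μ s) :
    ∃ X : α → ℝ, Measurable X ∧ (∀ x, X x ∈ Icc (-ε) ε) ∧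
      μ = ν.withDensity fun x ↦ ENNReal.ofReal (Real.exp (X x)) := by
  have hac : μ ≪ ν := Measure.AbsolutelyContinuous.mk fun s hs h ↦ by
    simpa [h] using hμν s hs
  have hint : ∀ s, ∫⁻ x in s, μ.rnDeriv ν x ∂ν = μ s := Measure.setLIntegral_rnDeriv hac
  have hupper : ∀ᵐ x ∂ν, μ.rnDeriv ν x ≤ ENNReal.ofReal (Real.exp ε) := by
    refine ae_le_of_forall_setLIntegral_le_of_sigmaFinite (Measure.measurable_rnDeriv μ ν)
      fun s hs _ ↦ ?_
    rw [hint, setLIntegral_const]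
    exact hμν s hs
  have hlower : ∀ᵐ x ∂ν, ENNReal.ofReal (Real.exp (-ε)) ≤ μ.rnDeriv ν x := by
    refine ae_le_of_forall_setLIntegral_le_of_sigmaFinite measurable_const fun s hs _ ↦ ?_
    rw [hint, setLIntegral_const]
    calc ENNReal.ofReal (Real.exp (-ε)) * ν s
        ≤ ENNReal.ofReal (Real.exp (-ε)) * (ENNReal.ofReal (Real.exp ε) * μ s) := by
          gcongr
          exact hνμ s hs
      _ = μ s := by
          rw [← mul_assoc, ← ENNReal.ofReal_mul (Real.exp_pos _).le, ← Real.exp_add]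
          simp
  refine ⟨fun x ↦ max (-ε) (min ε (Real.log (μ.rnDeriv ν x).toReal)), by fun_prop,
    fun x ↦ ⟨le_max_left _ _, max_le (by linarith) (min_le_left _ _)⟩, ?_⟩
  conv_lhs => rw [← Measure.withDensity_rnDeriv_eq μ ν hac]
  refine withDensity_congr_ae ?_
  filter_upwards [hupper, hlower] with x hu hl
  have hfin : μ.rnDeriv ν x ≠ ⊤ := ne_top_of_le_ne_top ENNReal.ofReal_ne_top hu
  have hl' : Real.exp (-ε) ≤ (μ.rnDeriv ν x).toReal :=
    (ENNReal.ofReal_le_iff_le_toReal hfin).1 hl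
  have hu' : (μ.rnDeriv ν x).toReal ≤ Real.exp ε :=
    ENNReal.toReal_le_of_le_ofReal (Real.exp_pos _).le hu
  have hpos : 0 < (μ.rnDeriv ν x).toReal := (Real.exp_pos _).trans_le hl'
  rw [min_eq_right ((Real.log_le_iff_le_exp hpos).2 hu'),
    max_eq_right ((Real.le_log_iff_exp_le hpos).2 hl'), Real.exp_log hpos, ENNReal.ofReal_toReal hfin]

/-- A log-likelihood ratio bounded by `ε` has mean at most `ε * (exp ε - 1)`. -/
theorem integral_logLikelihoodRatio_le {α : Type*} [MeasurableSpace α] {μ ν : Measure α}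
    [IsProbabilityMeasure μ] [IsProbabilityMeasure ν] {ε : ℝ} {X : α → ℝ} (hX : Measurable X)
    (hmem : ∀ x, X x ∈ Icc (-ε) ε)
    (hμ : μ = ν.withDensity fun x ↦ ENNReal.ofReal (Real.exp (X x))) :
    ∫ x, X x ∂μ ≤ ε * (Real.exp ε - 1) := by
  have hbdd : ∀ x, ‖Real.exp (X x)‖ ≤ Real.exp ε := fun x ↦ by
    rw [Real.norm_of_nonneg (Real.exp_pos _).le]
    exact Real.exp_le_exp.2 (hmem x).2
  have hexp : Integrable (fun x ↦ Real.exp (X x)) ν :=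
    Integrable.of_bound (by fun_prop) _ (ae_of_all _ hbdd)
  have hone : ∫ x, Real.exp (X x) ∂ν = 1 := by
    have h := measure_univ (μ := μ)
    rw [hμ, withDensity_apply _ MeasurableSet.univ, setLIntegral_univ] at h
    rw [integral_eq_lintegral_of_nonneg_ae (ae_of_all _ fun x ↦ (Real.exp_pos _).le) (by fun_prop),
      h, ENNReal.toReal_one]
  have hpt : ∀ x, Real.exp (X x) * X x ≤ ε * (Real.exp ε - 1) + (Real.exp (X x) - 1) := by
    intro x
    obtain ⟨hl, hu⟩ := hmem x
    have h1 : X x ≤ Real.exp (X x) - 1 := by linarith [Real.add_one_le_exp (X x)]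
    have hε : 0 ≤ ε := by linarith
    have h2 : (Real.exp (X x) - 1) * X x ≤ (Real.exp ε - 1) * ε := by
      rcases le_total 0 (X x) with h0 | h0
      · have := Real.exp_le_exp.2 hu
        have := Real.one_le_exp hε
        gcongr
      · have hle : 1 - Real.exp (X x) ≤ Real.exp ε - 1 := by
          have := Real.add_one_le_exp (X x)
          have := Real.add_one_le_exp ε
          linarith
        have hnn : 0 ≤ 1 - Real.exp (X x) := by linarith [Real.exp_le_one_iff.2 h0]
        nlinarith [mul_le_mul hle (neg_le.1 hl) (by linarith) (by linarith)]
    linarith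
  calc ∫ x, X x ∂μ = ∫ x, Real.exp (X x) * X x ∂ν := by
        rw [hμ, integral_withDensity_eq_integral_toReal_smul (by fun_prop) (by simp)]
        simp [ENNReal.toReal_ofReal (Real.exp_pos _).le]
    _ ≤ ∫ x, (ε * (Real.exp ε - 1) + (Real.exp (X x) - 1)) ∂ν := by
        refine integral_mono (hexp.mul_bdd (c := ε) (by fun_prop)
          (ae_of_all _ fun x ↦ abs_le.2 (hmem x))) ?_ hpt
        exact (integrable_const _).add (hexp.sub (integrable_const _))
    _ = ε * (Real.exp ε - 1) := by
        rw [integral_add (g := fun x ↦ Real.exp (X x) - 1) (integrable_const _)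
            (hexp.sub (integrable_const _)), integral_sub hexp (integrable_const _), hone]
        simp

/-- The product of probability measures given by densities is given by the product density. -/
theorem pi_withDensity {ι : Type*} [Fintype ι] {α : ι → Type*} [∀ i, MeasurableSpace (α i)]
    {μ ν : ∀ i, Measure (α i)} [∀ i, IsProbabilityMeasure (μ i)] [∀ i, IsProbabilityMeasure (ν i)]
    {f : ∀ i, α i → ENNReal} (hf : ∀ i, Measurable (f i)) (hμ : ∀ i, μ i = (ν i).withDensity (f i)) :
    Measure.pi μ = (Measure.pi ν).withDensity fun x ↦ ∏ i, f i (x i) := by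
  refine Measure.pi_eq fun s hs ↦ ?_
  have hind : ∀ i, Measurable ((s i).indicator (f i)) := fun i ↦ (hf i).indicator (hs i)
  have hprod : (univ.pi s).indicator (fun x ↦ ∏ i, f i (x i)) =
      fun x ↦ ∏ i, (s i).indicator (f i) (x i) := by
    ext x
    by_cases hx : x ∈ univ.pi s
    · rw [indicator_of_mem hx]
      exact Finset.prod_congr rfl fun i _ ↦ (indicator_of_mem (hx i (mem_univ i)) _).symm
    · rw [indicator_of_notMem hx]
      obtain ⟨i, hi⟩ : ∃ i, x i ∉ s i := by simpa [mem_univ_pi] using hx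
      exact (Finset.prod_eq_zero (Finset.mem_univ i) (indicator_of_notMem hi _)).symm
  rw [withDensity_apply _ (MeasurableSet.univ_pi hs), ← lintegral_indicator (MeasurableSet.univ_pi hs),
    hprod, lintegral_prod_eq_prod_lintegral_of_indepFun _ _
      (iIndepFun_pi fun i ↦ (hind i).aemeasurable) fun i ↦ (hind i).comp (measurable_pi_apply i)]
  refine Finset.prod_congr rfl fun i _ ↦ ?_
  rw [hμ, withDensity_apply _ (hs i), ← lintegral_indicator (hs i)]
  exact (measurePreserving_eval ν i).lintegral_comp (hind i)

/-- Hoeffding's inequality for a sum of independent coordinates with values in `[-ε, ε]` and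
means at most `m`. -/
theorem measureReal_pi_lt_sum_le {k : ℕ} {R : Fin k → Type*} [∀ i, MeasurableSpace (R i)]
    {μ : ∀ i, Measure (R i)} [∀ i, IsProbabilityMeasure (μ i)] {ε m δ : ℝ} (hε : 0 ≤ ε)
    (hm : 0 ≤ m) (hδ : δ ∈ Ioo (0 : ℝ) 1) {X : ∀ i, R i → ℝ} (hX : ∀ i, Measurable (X i))
    (hmem : ∀ i x, X i x ∈ Icc (-ε) ε) (hmean : ∀ i, ∫ x, X i x ∂μ i ≤ m) :
    (Measure.pi μ).real {x | Real.sqrt (2 * k * Real.log (1 / δ)) * ε + k * m < ∑ i, X i (x i)}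
      ≤ δ := by
  have hlog : 0 ≤ Real.log (1 / δ) := Real.log_nonneg (by rw [le_div_iff₀ hδ.1]; linarith [hδ.2])
  set t := Real.sqrt (2 * k * Real.log (1 / δ)) * ε with ht
  have ht0 : 0 ≤ t := by positivity
  have hsum : ∀ x : ∀ i, R i, ∑ i, X i (x i) ≤ k * ε := fun x ↦ by
    simpa using Finset.sum_le_sum fun i (_ : i ∈ Finset.univ) ↦ (hmem i (x i)).2
  rcases eq_or_ne ((k : ℝ) * ε) 0 with h0 | h0
  · have hempty : {x : ∀ i, R i | t + k * m < ∑ i, X i (x i)} = ∅ := by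
      refine eq_empty_of_forall_notMem fun x hx ↦ ?_
      have hx' : t + k * m < ∑ i, X i (x i) := hx
      have : 0 ≤ k * m := by positivity
      linarith [hsum x]
    simpa [hempty] using hδ.1.le
  have hsub : ∀ i, HasSubgaussianMGF (fun x : ∀ i, R i ↦ X i (x i) - ∫ y, X i y ∂μ i)
      ((‖ε - -ε‖₊ / 2) ^ 2) (Measure.pi μ) := fun i ↦
    HasSubgaussianMGF.of_map (Y := Function.eval i) (X := fun y ↦ X i y - ∫ y, X i y ∂μ i)
      (measurable_pi_apply i).aemeasurable <| by
        rw [(measurePreserving_eval μ i).map_eq]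
        exact hasSubgaussianMGF_of_mem_Icc (hX i).aemeasurable (ae_of_all _ (hmem i))
  have hindep : iIndepFun (fun i (x : ∀ i, R i) ↦ X i (x i) - ∫ y, X i y ∂μ i) (Measure.pi μ) :=
    iIndepFun_pi (X := fun i y ↦ X i y - ∫ y, X i y ∂μ i)
      fun i ↦ ((hX i).sub_const _).aemeasurable
  calc _ ≤ (Measure.pi μ).real {x | t ≤ ∑ i, (X i (x i) - ∫ y, X i y ∂μ i)} := by
        refine measureReal_mono fun x hx ↦ ?_
        have hx' : t + k * m < ∑ i, X i (x i) := hx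
        have : ∑ i, ∫ y, X i y ∂μ i ≤ k * m := by
          simpa using Finset.sum_le_sum fun i (_ : i ∈ Finset.univ) ↦ hmean i
        rw [mem_ofPred_eq, Finset.sum_sub_distrib]
        linarith
    _ ≤ _ := HasSubgaussianMGF.measure_sum_ge_le_of_iIndepFun hindep (fun i _ ↦ hsub i) ht0
    _ = δ := by
        have hc : 2 * (((∑ _i : Fin k, (‖ε - -ε‖₊ / 2) ^ 2 : NNReal)) : ℝ) = 2 * k * ε ^ 2 := by
          push_cast
          rw [Finset.sum_const, Finset.card_univ, Fintype.card_fin, nsmul_eq_mul,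
            Real.norm_of_nonneg (by linarith)]
          ring
        have hk : (k : ℝ) ≠ 0 := left_ne_zero_of_mul h0
        have hε0 : ε ≠ 0 := right_ne_zero_of_mul h0
        have hexponent : -t ^ 2 / (2 * k * ε ^ 2) = Real.log δ := by
          rw [ht, mul_pow, Real.sq_sqrt (by positivity), one_div, Real.log_inv]
          field_simp
        rw [hc, hexponent, Real.exp_log hδ.1]

/-- Advanced composition for product measures whose factors have bounded log-likelihood ratios. -/
theorem pi_le_exp_mul_pi_add {k : ℕ} {R : Fin k → Type*} [∀ i, MeasurableSpace (R i)]
    {μ ν : ∀ i, Measure (R i)} [∀ i, IsProbabilityMeasure (μ i)] [∀ i, IsProbabilityMeasure (ν i)]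
    {ε δ : ℝ} (hε : 0 ≤ ε) (hδ : δ ∈ Ioo (0 : ℝ) 1)
    (hμν : ∀ i s, MeasurableSet s → μ i s ≤ ENNReal.ofReal (Real.exp ε) * ν i s)
    (hνμ : ∀ i s, MeasurableSet s → ν i s ≤ ENNReal.ofReal (Real.exp ε) * μ i s)
    {S : Set (∀ i, R i)} (hS : MeasurableSet S) :
    Measure.pi μ S ≤ ENNReal.ofReal (Real.exp
      (Real.sqrt (2 * k * Real.log (1 / δ)) * ε + k * ε * (Real.exp ε - 1))) * Measure.pi ν S
        + ENNReal.ofReal δ := by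
  choose X hX hmem hdens using
    fun i ↦ exists_logLikelihoodRatio_mem_Icc hε (hμν i) (hνμ i)
  have hm : 0 ≤ ε * (Real.exp ε - 1) := mul_nonneg hε (by linarith [Real.one_le_exp hε])
  have htail := measureReal_pi_lt_sum_le hε hm hδ hX hmem
    fun i ↦ integral_logLikelihoodRatio_le (hX i) (hmem i) (hdens i)
  rw [← mul_assoc] at htail
  set L := Real.sqrt (2 * k * Real.log (1 / δ)) * ε + k * ε * (Real.exp ε - 1)
  set B := {x : ∀ i, R i | L < ∑ i, X i (x i)} with hB
  have hBm : MeasurableSet B := measurableSet_lt measurable_const (by fun_prop)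
  have hdiff : Measure.pi μ (S \ B) ≤ ENNReal.ofReal (Real.exp L) * Measure.pi ν S := by
    rw [pi_withDensity (fun i ↦ by fun_prop) hdens, withDensity_apply _ (hS.diff hBm)]
    calc ∫⁻ x in S \ B, ∏ i, ENNReal.ofReal (Real.exp (X i (x i))) ∂Measure.pi ν
        ≤ ∫⁻ _ in S \ B, ENNReal.ofReal (Real.exp L) ∂Measure.pi ν := by
          refine setLIntegral_mono measurable_const fun x hx ↦ ?_
          rw [← ENNReal.ofReal_prod_of_nonneg fun i _ ↦ (Real.exp_pos _).le, ← Real.exp_sum]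
          gcongr
          exact not_lt.1 hx.2
      _ ≤ _ := by
          rw [setLIntegral_const]
          gcongr
          exact sdiff_subset
  calc Measure.pi μ S ≤ Measure.pi μ (S \ B ∪ B) := measure_mono (by simp)
    _ ≤ Measure.pi μ (S \ B) + Measure.pi μ B := measure_union_le _ _
    _ ≤ _ := by
        gcongr
        exact (ENNReal.le_ofReal_iff_toReal_le (measure_ne_top _ _) hδ.1.le).2 htail

/-- Advanced composition (non-adaptive form): if each `Mᵢ` is `(ε', 0)`-differentially
private, then for any `δ ∈ (0, 1)` the product mechanism `D ↦ ⨂ᵢ Mᵢ(D)` is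
`(ε, δ)`-differentially private with `ε = √(2k ln(1/δ)) ε' + k ε' (e^{ε'} − 1)`. -/
theorem advanced_composition {𝓓 : Type*} {n k : ℕ} {R : Fin k → Type*}
    [∀ i, MeasurableSpace (R i)]
    (M : ∀ i : Fin k, (Fin n → 𝓓) → Measure (R i))
    (hprob : ∀ (i : Fin k) (D : Fin n → 𝓓), IsProbabilityMeasure (M i D))
    (ε' : ℝ) (hM : ∀ i : Fin k, DiffPrivate (M i) ε' 0)
    (δ : ℝ) (hδ : δ ∈ Set.Ioo (0 : ℝ) 1) :
    DiffPrivate (fun D => Measure.pi (fun i => M i D))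
      (Real.sqrt (2 * k * Real.log (1 / δ)) * ε' + k * ε' * (Real.exp ε' - 1)) δ := by
  intro D D' hDD' S hS
  have hD'D : Neighboring D' D := hDD'.imp fun i hi j hj ↦ (hi j hj).symm
  have hle : ∀ (i : Fin k) (E E' : Fin n → 𝓓), Neighboring E E' → ∀ s, MeasurableSet s →
      M i E s ≤ ENNReal.ofReal (Real.exp ε') * M i E' s := fun i E E' h s hs ↦ by
    simpa using hM i E E' h s hs
  rcases Nat.eq_zero_or_pos k with rfl | hk
  · have h : (fun i ↦ M i D) = fun i ↦ M i D' := Subsingleton.elim _ _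
    simp [h]
  have hε : 0 ≤ ε' := by
    have h := hle ⟨0, hk⟩ D D' hDD' univ MeasurableSet.univ
    rw [measure_univ, measure_univ, mul_one, ENNReal.one_le_ofReal] at h
    exact Real.one_le_exp_iff.1 h
  exact pi_le_exp_mul_pi_add hε hδ (fun i ↦ hle i D D' hDD') (fun i ↦ hle i D' D hD'D) hS
end

section
/- Privacy of the Laplace mechanism: Let q : 𝓓^n → ℝ be a query with global sensitivity at most Δ > 0, i.e., |q(D) − q(D')| ≤ Δ for all neighboring D, D'. For ε > 0, the Laplace mechanism M that maps D to the distribution of q(D) + Y, where Y is drawn from the Laplace distribution with mean 0 and scale Δ/ε (equivalently, M(D) is the translate by q(D) of the Laplace measure of scale Δ/ε), is (ε, 0)-differentially private. -/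
open MeasureTheory

/-- The Laplace distribution with mean `0` and scale `b`: the measure on `ℝ`
with density `x ↦ (1/(2b)) e^{−|x|/b}` with respect to Lebesgue measure. -/
noncomputable def laplaceMeasure (b : ℝ) : Measure ℝ :=
  volume.withDensity fun x => ENNReal.ofReal ((1 / (2 * b)) * Real.exp (-|x| / b))

/-- The translate of the Laplace measure by `a` has density `x ↦ (1/(2b)) e^{−|x - a|/b}`. -/
theorem map_add_laplaceMeasure_apply (a b : ℝ) {S : Set ℝ} (hS : MeasurableSet S) :
    (laplaceMeasure b).map (fun y => a + y) S =
      ∫⁻ x in S, ENNReal.ofReal ((1 / (2 * b)) * Real.exp (-|x - a| / b)) := by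
  have ha : Measurable fun y : ℝ => a + y := measurable_const_add a
  rw [Measure.map_apply ha hS, laplaceMeasure, withDensity_apply _ (ha hS),
    ← (measurePreserving_add_left volume a).setLIntegral_comp_preimage hS (by fun_prop)]
  simp only [add_sub_cancel_left]

/-- Moving the center of the Laplace density by at most `Δ` changes it by a factor of at most
`e^ε` when the scale is `Δ / ε`. -/
theorem laplace_density_le {a a' Δ ε : ℝ} (hΔ : 0 < Δ) (hε : 0 < ε) (h : |a - a'| ≤ Δ) (x : ℝ) :
    (1 / (2 * (Δ / ε))) * Real.exp (-|x - a| / (Δ / ε)) ≤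
      Real.exp ε * ((1 / (2 * (Δ / ε))) * Real.exp (-|x - a'| / (Δ / ε))) := by
  have hb : 0 < Δ / ε := div_pos hΔ hε
  rw [mul_left_comm, ← Real.exp_add]
  gcongr
  have htri : |x - a'| ≤ |x - a| + |a - a'| := abs_sub_le x a a'
  have hscale : ε = Δ / (Δ / ε) := by field_simp
  calc -|x - a| / (Δ / ε) ≤ (Δ + -|x - a'|) / (Δ / ε) := by gcongr; linarith
    _ = ε + -|x - a'| / (Δ / ε) := by rw [add_div, ← hscale]

/-- Privacy of the Laplace mechanism: if `q` has global sensitivity at most `Δ > 0`,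
then the mechanism `D ↦` (distribution of `q(D) + Y` with `Y ∼ Lap(Δ/ε)`) is
`(ε, 0)`-differentially private. -/
theorem laplace_mechanism_private {𝓓 : Type*} {n : ℕ} (q : (Fin n → 𝓓) → ℝ)
    (Δ ε : ℝ) (hΔ : 0 < Δ) (hε : 0 < ε)
    (hsens : ∀ D D' : Fin n → 𝓓, Neighboring D D' → |q D - q D'| ≤ Δ) :
    DiffPrivate (fun D => (laplaceMeasure (Δ / ε)).map (fun y => q D + y)) ε 0 := by
  intro D D' hDD' S hS
  simp only [ENNReal.ofReal_zero, add_zero, map_add_laplaceMeasure_apply _ _ hS]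
  rw [← lintegral_const_mul' _ _ ENNReal.ofReal_ne_top]
  refine lintegral_mono fun x => ?_
  rw [← ENNReal.ofReal_mul (Real.exp_pos ε).le]
  exact ENNReal.ofReal_le_ofReal (laplace_density_le hΔ hε (hsens D D' hDD') x)
end

section
/- Effect of artificial ordering on Pearson correlation (Appendix A): Let n ≥ 2 and 1 ≤ k ≤ n be natural numbers. Define x, y : {1, ..., n} → ℝ by x_i = i for all i, and y_i = k + 1 − i for 1 ≤ i ≤ k, y_i = i for k < i ≤ n (the first k values appear in reversed order). Then the Pearson correlation coefficient of x and y equals r = 1 − 2k(k + 1)(k − 1)/(n(n + 1)(n − 1)). Equivalently, writing r_0 = 1 for the correlation with the identity order, r_0 − r = 2k(k² − 1)/(n(n² − 1)); in particular r = −1 when k = n (full reversal of order). -/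
open Finset

/-- The Pearson correlation coefficient of two sequences `x, y : Fin n → ℝ`. -/
noncomputable def pearson {n : ℕ} (x y : Fin n → ℝ) : ℝ :=
  (∑ i, (x i - (∑ j, x j) / n) * (y i - (∑ j, y j) / n)) /
    Real.sqrt
      ((∑ i, (x i - (∑ j, x j) / n) ^ 2) * (∑ i, (y i - (∑ j, y j) / n) ^ 2))

theorem sum_range_ite_succ_le (a b : ℕ → ℝ) {n k : ℕ} (hkn : k ≤ n) :
    ∑ i ∈ range n, (if i + 1 ≤ k then a i else b i) =
      ∑ i ∈ range k, a i + (∑ i ∈ range n, b i - ∑ i ∈ range k, b i) := by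
  induction n, hkn using Nat.le_induction with
  | base =>
    rw [sub_self, add_zero]
    exact sum_congr rfl fun i hi => if_pos (mem_range.mp hi)
  | succ m hm ih =>
    rw [sum_range_succ, ih, sum_range_succ, if_neg (by omega)]
    ring

theorem sum_range_succ_cast (n : ℕ) :
    ∑ i ∈ range n, ((i : ℝ) + 1) = n * (n + 1) / 2 := by
  induction n with
  | zero => simp
  | succ m ih => rw [sum_range_succ, ih]; push_cast; ring

theorem sum_range_succ_cast_sq (n : ℕ) :
    ∑ i ∈ range n, ((i : ℝ) + 1) ^ 2 = (n : ℝ) * (n + 1) * (2 * n + 1) / 6 := by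
  induction n with
  | zero => simp
  | succ m ih => rw [sum_range_succ, ih]; push_cast; ring

theorem sum_sub_mul_sub {n : ℕ} (x y : Fin n → ℝ) (a b : ℝ) :
    ∑ i, (x i - a) * (y i - b) =
      ∑ i, x i * y i - b * ∑ i, x i - a * ∑ i, y i + n * (a * b) := by
  have h (i : Fin n) :
      (x i - a) * (y i - b) = x i * y i - b * x i - a * y i + a * b := by ring
  simp only [h, sum_add_distrib, sum_sub_distrib, ← mul_sum, sum_const, card_univ,
    Fintype.card_fin, nsmul_eq_mul]
  ring

/-- The sequence `1, …, n` (indexed from `0`) with its first `k` values reversed. -/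
def prefixReversed (k i : ℕ) : ℝ :=
  if i + 1 ≤ k then (k : ℝ) + 1 - ((i : ℝ) + 1) else (i : ℝ) + 1

theorem sum_prefixReversed {n k : ℕ} (hkn : k ≤ n) :
    ∑ i ∈ range n, prefixReversed k i = n * (n + 1) / 2 := by
  simp only [prefixReversed]
  rw [sum_range_ite_succ_le _ _ hkn, sum_sub_distrib, sum_range_succ_cast,
    sum_range_succ_cast, sum_const, card_range, nsmul_eq_mul]
  ring

theorem sum_prefixReversed_sq {n k : ℕ} (hkn : k ≤ n) :
    ∑ i ∈ range n, prefixReversed k i ^ 2 = (n : ℝ) * (n + 1) * (2 * n + 1) / 6 := by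
  have h (i : ℕ) : prefixReversed k i ^ 2 = if i + 1 ≤ k then
      ((k : ℝ) + 1) ^ 2 - 2 * (k + 1) * ((i : ℝ) + 1) + ((i : ℝ) + 1) ^ 2
      else ((i : ℝ) + 1) ^ 2 := by
    unfold prefixReversed
    split_ifs <;> ring
  simp only [h]
  rw [sum_range_ite_succ_le _ _ hkn, sum_add_distrib, sum_sub_distrib, ← mul_sum,
    sum_range_succ_cast, sum_range_succ_cast_sq, sum_range_succ_cast_sq, sum_const,
    card_range, nsmul_eq_mul]
  ring

theorem sum_succ_mul_prefixReversed {n k : ℕ} (hkn : k ≤ n) :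
    ∑ i ∈ range n, ((i : ℝ) + 1) * prefixReversed k i =
      n * (n + 1) * (2 * n + 1) / 6 - k * (k + 1) * (k - 1) / 6 := by
  have h (i : ℕ) : ((i : ℝ) + 1) * prefixReversed k i = if i + 1 ≤ k then
      ((k : ℝ) + 1) * ((i : ℝ) + 1) - ((i : ℝ) + 1) ^ 2 else ((i : ℝ) + 1) ^ 2 := by
    unfold prefixReversed
    split_ifs <;> ring
  simp only [h]
  rw [sum_range_ite_succ_le _ _ hkn, sum_sub_distrib, ← mul_sum,
    sum_range_succ_cast, sum_range_succ_cast_sq, sum_range_succ_cast_sq]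
  ring

/-- Effect of artificial ordering on Pearson correlation: if `x` is the identity
order `1, …, n` and `y` reverses the order of the first `k` values
(`y_i = k + 1 − i` for `i ≤ k`, `y_i = i` otherwise), then their Pearson
correlation equals `1 − 2k(k+1)(k−1)/(n(n+1)(n−1))`; in particular it is `−1`
for `k = n` (full reversal). -/
theorem pearson_artificial_order {n k : ℕ} (hn : 2 ≤ n) (hk1 : 1 ≤ k) (hkn : k ≤ n) :
    pearson (fun i : Fin n => ((i : ℕ) + 1 : ℝ))
        (fun i : Fin n =>
          if (i : ℕ) + 1 ≤ k then (k : ℝ) + 1 - ((i : ℕ) + 1) else ((i : ℕ) + 1 : ℝ)) =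
      1 - 2 * k * (k + 1) * (k - 1) / ((n : ℝ) * (n + 1) * (n - 1)) := by
  change pearson (fun i : Fin n => ((i : ℕ) + 1 : ℝ))
    (fun i : Fin n => prefixReversed k i) = _
  have hn' : (2 : ℝ) ≤ n := by exact_mod_cast hn
  have hn0 : (n : ℝ) ≠ 0 := by positivity
  have hn1 : (n : ℝ) - 1 ≠ 0 := by linarith
  have hx : ∑ i : Fin n, ((i : ℕ) + 1 : ℝ) = n * (n + 1) / 2 := by
    rw [← sum_range_succ_cast, sum_range]
  have hy : ∑ i : Fin n, prefixReversed k i = n * (n + 1) / 2 := by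
    rw [← sum_prefixReversed hkn, sum_range]
  have hxx : ∑ i : Fin n, ((i : ℕ) + 1 : ℝ) ^ 2 = (n : ℝ) * (n + 1) * (2 * n + 1) / 6 := by
    rw [← sum_range_succ_cast_sq, sum_range]
  have hyy : ∑ i : Fin n, prefixReversed k i ^ 2 = (n : ℝ) * (n + 1) * (2 * n + 1) / 6 := by
    rw [← sum_prefixReversed_sq hkn, sum_range]
  have hxy : ∑ i : Fin n, ((i : ℕ) + 1 : ℝ) * prefixReversed k i =
      n * (n + 1) * (2 * n + 1) / 6 - k * (k + 1) * (k - 1) / 6 := by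
    rw [← sum_succ_mul_prefixReversed hkn, sum_range]
  have hvar : (n * (n + 1) * (2 * n + 1) / 6 - n * (n + 1) / 2 / n * (n * (n + 1) / 2) -
      n * (n + 1) / 2 / n * (n * (n + 1) / 2) +
      n * (n * (n + 1) / 2 / n) ^ 2 : ℝ) =
      n * (n + 1) * (n - 1) / 12 := by
    field_simp
    ring
  unfold pearson
  simp only [pow_two, sum_sub_mul_sub]
  simp only [← pow_two, hx, hy, hxx, hyy, hxy, hvar]
  rw [Real.sqrt_sq (by
    have : (0 : ℝ) ≤ n - 1 := by linarith
    positivity)]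
  field_simp
  ring
end

section
/- High global sensitivity of Pearson correlation on binary attributes (Appendix C): The sequence a_n = √(1 − 1/n) − √(n − 2)/√(2(n − 1)) converges to 1 − 1/√2 as n → ∞; in particular, for all sufficiently large n, a_n ≥ 0.29. Since √(1 − 1/n) and √(n − 2)/√(2(n − 1)) are the Pearson correlation coefficients of two neighboring n-row binary two-column databases (differing in a single row), the global sensitivity of the Pearson product-moment correlation coefficient over binary attributes is at least 0.29 for all sufficiently large n. -/
open Finset Filter

/-- The sum of products of deviations from the mean, in expanded form. -/
theorem sum_sub_mean_mul_sub_mean {n : ℕ} (hn : n ≠ 0) (x y : Fin n → ℝ) :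
    ∑ i, (x i - (∑ j, x j) / n) * (y i - (∑ j, y j) / n) =
      ∑ i, x i * y i - (∑ i, x i) * (∑ i, y i) / n := by
  have hn' : (n : ℝ) ≠ 0 := Nat.cast_ne_zero.mpr hn
  simp only [sub_mul, mul_sub, Finset.sum_sub_distrib, ← Finset.mul_sum, ← Finset.sum_mul,
    Finset.sum_const, Finset.card_univ, Fintype.card_fin, nsmul_eq_mul]
  field_simp
  ring

/-- The Pearson correlation coefficient of two indicator sequences. -/
theorem pearson_indicator {n : ℕ} (hn : n ≠ 0) (s t : Finset (Fin n)) :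
    pearson (fun i => if i ∈ s then 1 else 0) (fun i => if i ∈ t then 1 else 0) =
      (#(s ∩ t) - #s * #t / n : ℝ) /
        Real.sqrt ((#s - #s * #s / n) * (#t - #t * #t / n)) := by
  simp only [pearson, sq, sum_sub_mean_mul_sub_mean hn]
  simp [← ite_and, ← Finset.mem_inter, Finset.inter_comm]

theorem pearson_indicator_singleton_self {n : ℕ} (hn : 2 ≤ n) (a : Fin n) :
    pearson (fun i => if i ∈ ({a} : Finset (Fin n)) then 1 else 0)
      (fun i => if i ∈ ({a} : Finset (Fin n)) then 1 else 0) = 1 := by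
  have hn' : (2 : ℝ) ≤ n := by exact_mod_cast hn
  have h : (0 : ℝ) < 1 - 1 / n := by
    rw [sub_pos, div_lt_one] <;> linarith
  rw [pearson_indicator (by lia)]
  simp only [Finset.inter_self, Finset.card_singleton, Nat.cast_one, mul_one]
  rw [Real.sqrt_mul_self h.le, div_self h.ne']

theorem pearson_indicator_singleton_pair {n : ℕ} (hn : 3 ≤ n) {a b : Fin n} (hab : a ≠ b) :
    pearson (fun i => if i ∈ ({a} : Finset (Fin n)) then 1 else 0)
      (fun i => if i ∈ ({a, b} : Finset (Fin n)) then 1 else 0) =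
      Real.sqrt ((n : ℝ) - 2) / Real.sqrt (2 * ((n : ℝ) - 1)) := by
  have hn' : (3 : ℝ) ≤ n := by exact_mod_cast hn
  have hn0 : (0 : ℝ) < n := by linarith
  have h2 : (0 : ℝ) < n - 2 := by linarith
  have h1 : (0 : ℝ) < 2 * (n - 1) := by linarith
  have hinter : ({a} : Finset (Fin n)) ∩ {a, b} = {a} := Finset.inter_eq_left.mpr (by simp)
  rw [pearson_indicator (by lia), hinter, Finset.card_pair hab, Finset.card_singleton]
  have hprod : (((1 : ℕ) : ℝ) - (1 : ℕ) * (1 : ℕ) / n) * ((2 : ℕ) - (2 : ℕ) * (2 : ℕ) / n) =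
      (2 * (n - 1)) * (n - 2) / (n : ℝ) ^ 2 := by
    push_cast
    field_simp
  have hnum : (((1 : ℕ) : ℝ) - (1 : ℕ) * (2 : ℕ) / n) =
      Real.sqrt (n - 2) * Real.sqrt (n - 2) / n := by
    rw [Real.mul_self_sqrt h2.le]
    push_cast
    field_simp
  rw [hprod, hnum, Real.sqrt_div (mul_pos h1 h2).le, Real.sqrt_sq hn0.le, Real.sqrt_mul h1.le]
  have := Real.sqrt_pos.mpr h1
  have := Real.sqrt_pos.mpr h2
  field_simp

theorem tendsto_sqrt_one_sub_inv_sub_sqrt_div_sqrt :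
    Tendsto
      (fun n : ℕ =>
        Real.sqrt (1 - 1 / (n : ℝ)) - Real.sqrt ((n : ℝ) - 2) / Real.sqrt (2 * ((n : ℝ) - 1)))
      atTop (nhds (1 - 1 / Real.sqrt 2)) := by
  have hinv : Tendsto (fun n : ℕ => 1 / (n : ℝ)) atTop (nhds 0) :=
    tendsto_one_div_atTop_nhds_zero_nat
  have hfst : Tendsto (fun n : ℕ => Real.sqrt (1 - 1 / (n : ℝ))) atTop (nhds 1) := by
    simpa using (hinv.const_sub 1).sqrt
  have hquot : Tendsto
      (fun n : ℕ => (1 - 2 * (1 / (n : ℝ))) / (2 * (1 - 1 / (n : ℝ)))) atTop (nhds (1 / 2)) := by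
    have hlim :=
      ((hinv.const_mul 2).const_sub 1).div ((hinv.const_sub 1).const_mul 2) (by norm_num)
    rw [mul_zero, sub_zero, mul_one] at hlim
    exact hlim
  have hsnd : Tendsto
      (fun n : ℕ => Real.sqrt ((n : ℝ) - 2) / Real.sqrt (2 * ((n : ℝ) - 1))) atTop
      (nhds (1 / Real.sqrt 2)) := by
    have hlim := hquot.sqrt
    rw [Real.sqrt_div zero_le_one, Real.sqrt_one] at hlim
    refine hlim.congr' ?_
    filter_upwards [eventually_ge_atTop 3] with n hn
    have hn' : (3 : ℝ) ≤ n := by exact_mod_cast hn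
    have hn1 : (n : ℝ) - 1 ≠ 0 := by linarith
    rw [← Real.sqrt_div (by linarith)]
    congr 1
    field_simp
  exact hfst.sub hsnd

theorem eventually_le_sqrt_one_sub_inv_sub_sqrt_div_sqrt :
    ∀ᶠ n : ℕ in atTop, (0.29 : ℝ) ≤
      Real.sqrt (1 - 1 / (n : ℝ)) - Real.sqrt ((n : ℝ) - 2) / Real.sqrt (2 * ((n : ℝ) - 1)) := by
  refine tendsto_sqrt_one_sub_inv_sub_sqrt_div_sqrt.eventually_const_le ?_
  have h : (1.41 : ℝ) < Real.sqrt 2 := Real.lt_sqrt_of_sq_lt (by norm_num)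
  have h' : 1 / Real.sqrt 2 < 0.71 := by
    rw [div_lt_iff₀ (by linarith)]
    linarith
  linarith

/-- High global sensitivity of Pearson correlation on binary attributes: the
sequence `aₙ = √(1 − 1/n) − √(n − 2)/√(2(n − 1))` converges to `1 − 1/√2`, and for
all sufficiently large `n` we have `aₙ ≥ 0.29`; moreover, for all sufficiently
large `n` there exist two `n`-row two-column binary databases differing in exactly
one row whose Pearson correlation coefficients differ by at least `0.29`, so the
global sensitivity of the Pearson correlation over binary attributes is at least
`0.29` for sufficiently large `n`. -/
theorem pearson_binary_high_sensitivity :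
    Tendsto
      (fun n : ℕ =>
        Real.sqrt (1 - 1 / (n : ℝ)) - Real.sqrt ((n : ℝ) - 2) / Real.sqrt (2 * ((n : ℝ) - 1)))
      atTop (nhds (1 - 1 / Real.sqrt 2)) ∧
    (∀ᶠ n : ℕ in atTop,
      (0.29 : ℝ) ≤
        Real.sqrt (1 - 1 / (n : ℝ)) - Real.sqrt ((n : ℝ) - 2) / Real.sqrt (2 * ((n : ℝ) - 1))) ∧
    (∀ᶠ n : ℕ in atTop, ∃ D D' : Fin n → ℝ × ℝ,
      (∀ i, (D i).1 ∈ ({0, 1} : Set ℝ) ∧ (D i).2 ∈ ({0, 1} : Set ℝ)) ∧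
      (∀ i, (D' i).1 ∈ ({0, 1} : Set ℝ) ∧ (D' i).2 ∈ ({0, 1} : Set ℝ)) ∧
      (∃ i₀ : Fin n, D i₀ ≠ D' i₀ ∧ ∀ j : Fin n, j ≠ i₀ → D j = D' j) ∧
      (0.29 : ℝ) ≤
        |pearson (fun i => (D i).1) (fun i => (D i).2) -
          pearson (fun i => (D' i).1) (fun i => (D' i).2)|) := by
  refine ⟨tendsto_sqrt_one_sub_inv_sub_sqrt_div_sqrt,
    eventually_le_sqrt_one_sub_inv_sub_sqrt_div_sqrt, ?_⟩
  filter_upwards [eventually_le_sqrt_one_sub_inv_sub_sqrt_div_sqrt, eventually_ge_atTop 3]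
    with n hgap hn
  let a : Fin n := ⟨0, by lia⟩
  let b : Fin n := ⟨1, by lia⟩
  have hab : a ≠ b := by simp [a, b]
  refine ⟨fun i => (if i ∈ ({a} : Finset (Fin n)) then 1 else 0,
      if i ∈ ({a} : Finset (Fin n)) then 1 else 0),
    fun i => (if i ∈ ({a} : Finset (Fin n)) then 1 else 0,
      if i ∈ ({a, b} : Finset (Fin n)) then 1 else 0), ?_, ?_, ⟨b, ?_, ?_⟩, ?_⟩
  · intro i
    constructor <;> dsimp only <;> split_ifs <;> simp
  · intro i
    constructor <;> dsimp only <;> split_ifs <;> simp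
  · simp [hab.symm]
  · intro j hj
    simp [hj]
  · rw [pearson_indicator_singleton_self (by lia), pearson_indicator_singleton_pair hn hab]
    have hle : Real.sqrt (1 - 1 / (n : ℝ)) ≤ 1 :=
      Real.sqrt_le_one.mpr (sub_le_self _ (by positivity))
    exact le_trans (by linarith) (le_abs_self _)
end
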